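/- There exist C > 0 and ε₀ > 0 such that for all ε ∈ (0, ε₀) and j = 1,2: |C_j − (−1)^j μ_ε μ_j| ≤ Cε, where C_j = ((−1)^j/(8π a_ε))·(U(ξ_j) − U(0))/(U(ξ₁)U(ξ₂) − U(0)²). -/

import Mathlib

open Real

noncomputable section

/-- The distance parameter `a_ε`. -/
def aEps (r₁ r₂ ε : ℝ) : ℝ :=
  Real.sqrt ε * Real.sqrt ((2*r₁+ε)*(2*r₂+ε)*(2*r₁+2*r₂+ε)) / (2*(r₁+r₂+ε))

def xi (r : ℝ) (r₁ r₂ ε : ℝ) : ℝ := Real.arsinh (aEps r₁ r₂ ε / r)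

/-- `U(c) = ∑_{n≥0} e^{(2n+1)c}/(e^{(2n+1)s₀} − 1)`. -/
def U (s₀ c : ℝ) : ℝ := ∑' n : ℕ, Real.exp ((2*n+1) * c) / (Real.exp ((2*n+1) * s₀) - 1)

/-- The digamma value `ψ₀(z) = −γ + ∑_{k≥0} (z−1)/((k+1)(k+z))`. -/
def digammaVal (z : ℝ) : ℝ :=
  -Real.eulerMascheroniConstant + ∑' k : ℕ, (z - 1) / ((k + 1) * (k + z))

/-- `C_j` for `j = 1, 2` (with sign `(−1)^j`). -/
def Cconst (r₁ r₂ ε : ℝ) (j : ℕ) : ℝ :=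
  ((-1) ^ j / (8 * Real.pi * aEps r₁ r₂ ε)) *
    ((U (xi r₁ r₁ r₂ ε + xi r₂ r₁ r₂ ε) (xi (if j = 1 then r₁ else r₂) r₁ r₂ ε) -
        U (xi r₁ r₁ r₂ ε + xi r₂ r₁ r₂ ε) 0) /
      (U (xi r₁ r₁ r₂ ε + xi r₂ r₁ r₂ ε) (xi r₁ r₁ r₂ ε) *
        U (xi r₁ r₁ r₂ ε + xi r₂ r₁ r₂ ε) (xi r₂ r₁ r₂ ε) -
        (U (xi r₁ r₁ r₂ ε + xi r₂ r₁ r₂ ε) 0) ^ 2))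

def rTilde (r₁ r₂ : ℝ) : ℝ := r₁ * r₂ / (r₁ + r₂)

/-- `μ_j` for `j = 1, 2`. -/
def muConst (r₁ r₂ : ℝ) (j : ℕ) : ℝ :=
  (digammaVal ((if j = 1 then r₁ else r₂) / (r₁ + r₂)) + Real.eulerMascheroniConstant) /
    (digammaVal (r₁ / (r₁ + r₂)) + digammaVal (r₂ / (r₁ + r₂)) +
      2 * Real.eulerMascheroniConstant)

/-- `μ_ε`. -/
def muEps (r₁ r₂ ε : ℝ) : ℝ :=
  (1 / (2 * Real.pi * rTilde r₁ r₂)) *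
    (|Real.log ε| + Real.log (rTilde r₁ r₂) + Real.log 2 -
      2 * (digammaVal (r₁ / (r₁ + r₂)) * digammaVal (r₂ / (r₁ + r₂)) -
          Real.eulerMascheroniConstant ^ 2) /
        (digammaVal (r₁ / (r₁ + r₂)) + digammaVal (r₂ / (r₁ + r₂)) +
          2 * Real.eulerMascheroniConstant))⁻¹

open Filter Topology Asymptotics

/-- Dividing out a zero preserves real analyticity. -/
lemma analyticAt_dslope {f : ℝ → ℝ} (hf : ∀ x, AnalyticAt ℝ f x) (a x : ℝ) :
    AnalyticAt ℝ (dslope f a) x := by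
  rcases eq_or_ne x a with rfl | h
  · obtain ⟨p, hp⟩ := hf x
    exact ⟨_, hp.has_fpower_series_dslope_fslope⟩
  · have h1 : AnalyticAt ℝ (fun b => (b - a)⁻¹ * (f b - f a)) x := by
      refine AnalyticAt.mul ?_ ((hf x).sub analyticAt_const)
      exact (analyticAt_id.sub analyticAt_const).inv (sub_ne_zero.2 h)
    refine h1.congr ?_
    filter_upwards [dslope_eventuallyEq_slope_of_ne f h] with b hb
    rw [hb, slope_def_field, div_eq_inv_mul]

/-- The entire function `sinh x / x`, with value `1` at the origin. -/
def sinhDiv : ℝ → ℝ := dslope Real.sinh 0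

lemma analyticAt_sinhDiv (x : ℝ) : AnalyticAt ℝ sinhDiv x :=
  analyticAt_dslope (fun _ => Real.analyticAt_sinh) 0 x

lemma sinhDiv_zero : sinhDiv 0 = 1 := by simp [sinhDiv, dslope_same]

lemma sinhDiv_of_ne {x : ℝ} (hx : x ≠ 0) : sinhDiv x = Real.sinh x / x := by
  simp [sinhDiv, dslope_of_ne _ hx, slope_def_field]

lemma sinhDiv_pos (x : ℝ) : 0 < sinhDiv x := by
  rcases lt_trichotomy x 0 with h | rfl | h
  · rw [sinhDiv_of_ne h.ne]
    exact div_pos_of_neg_of_neg (Real.sinh_neg_iff.2 h) h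
  · simp [sinhDiv_zero]
  · rw [sinhDiv_of_ne h.ne']
    exact div_pos (Real.sinh_pos_iff.2 h) h

/-- The function `1 / sinh x - 1 / x`, extended by `0` to the origin. -/
def cschReg : ℝ → ℝ := dslope (fun x => (sinhDiv x)⁻¹) 0

lemma analyticAt_cschReg (x : ℝ) : AnalyticAt ℝ cschReg x :=
  analyticAt_dslope (fun y => (analyticAt_sinhDiv y).inv (sinhDiv_pos y).ne') 0 x

lemma contDiff_cschReg {n : WithTop ℕ∞} : ContDiff ℝ n cschReg :=
  contDiff_iff_contDiffAt.2 fun x => (analyticAt_cschReg x).contDiffAt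

lemma cschReg_of_ne {x : ℝ} (hx : x ≠ 0) : cschReg x = 1 / Real.sinh x - 1 / x := by
  have hs : Real.sinh x ≠ 0 := Real.sinh_ne_zero.2 hx
  rw [cschReg, dslope_of_ne _ hx, slope_def_field, sinhDiv_of_ne hx, sinhDiv_zero]
  field_simp
  ring

lemma cschReg_zero : cschReg 0 = 0 := by
  have hc : Continuous cschReg := (contDiff_cschReg (n := 0)).continuous
  have h : (fun x => cschReg (-x)) = fun x => -cschReg x := by
    refine Continuous.ext_on (dense_compl_singleton (0 : ℝ)) (by fun_prop) (by fun_prop) ?_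
    intro x hx
    have hx : x ≠ 0 := hx
    simp only [cschReg_of_ne hx, cschReg_of_ne (neg_ne_zero.2 hx), Real.sinh_neg]
    field_simp
    ring
  have := congrFun h 0
  simp only [neg_zero] at this
  linarith

lemma deriv_deriv_cschReg {x : ℝ} (hx : 0 < x) :
    deriv (deriv cschReg) x = (2 + Real.sinh x ^ 2) / Real.sinh x ^ 3 - 2 / x ^ 3 := by
  have h1 : ∀ y : ℝ, 0 < y →
      HasDerivAt cschReg (-Real.cosh y / Real.sinh y ^ 2 + 1 / y ^ 2) y := by
    intro y hy
    have hs : Real.sinh y ≠ 0 := Real.sinh_ne_zero.2 hy.ne'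
    have := ((Real.hasDerivAt_sinh y).inv hs).sub (hasDerivAt_inv hy.ne')
    have h2 := this.congr_of_eventuallyEq (f₁ := cschReg) (by
      filter_upwards [eventually_ne_nhds hy.ne'] with z hz
      simp [cschReg_of_ne hz])
    exact h2.congr_deriv (by ring)
  have h2 : deriv cschReg =ᶠ[𝓝 x] fun y => -Real.cosh y / Real.sinh y ^ 2 + 1 / y ^ 2 := by
    filter_upwards [eventually_gt_nhds hx] with y hy using (h1 y hy).deriv
  rw [h2.deriv_eq]
  have hs : Real.sinh x ≠ 0 := Real.sinh_ne_zero.2 hx.ne'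
  have h3 := (((Real.hasDerivAt_cosh x).neg.div ((Real.hasDerivAt_sinh x).pow 2)
    (pow_ne_zero 2 hs)).add ((hasDerivAt_const x (1 : ℝ)).div (hasDerivAt_pow 2 x)
    (pow_ne_zero 2 hx.ne')))
  have h4 := h3.deriv
  have hc := Real.cosh_sq x
  have h5 : deriv (fun y => -Real.cosh y / Real.sinh y ^ 2 + 1 / y ^ 2) x = _ := h4
  rw [h5]
  field_simp
  simp
  ring_nf
  rw [hc]
  ring

lemma exists_bound_deriv_deriv_cschReg :
    ∃ K > 0, ∀ x : ℝ, 0 ≤ x → |deriv (deriv cschReg) x| ≤ K / (1 + x) ^ 2 := by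
  have hcont : Continuous (deriv (deriv cschReg)) := by
    have := (contDiff_cschReg (n := 2)).continuous_iteratedDeriv 2 le_rfl
    rwa [iteratedDeriv_eq_iterate] at this
  obtain ⟨M, hM⟩ := (isCompact_Icc (a := (0 : ℝ)) (b := 1)).exists_bound_of_continuousOn
    hcont.continuousOn
  refine ⟨4 * |M| + 200, by positivity, fun x hx => ?_⟩
  rw [le_div_iff₀ (by positivity)]
  rcases le_total x 1 with h | h
  · have := (hM x ⟨hx, h⟩).trans (le_abs_self M)
    rw [Real.norm_eq_abs] at this
    have h2 : (1 + x) ^ 2 ≤ 4 := by nlinarith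
    calc _ ≤ |M| * 4 := mul_le_mul this h2 (by positivity) (abs_nonneg _)
      _ ≤ _ := by linarith
  · have hx0 : 0 < x := by linarith
    rw [deriv_deriv_cschReg hx0]
    have hs1 : x ≤ Real.sinh x := Real.self_le_sinh_iff.2 hx
    have hs2 : x ^ 2 / 4 ≤ Real.sinh x := by
      rw [Real.sinh_eq]
      have h1 := Real.quadratic_le_exp_of_nonneg hx
      have h2 : Real.exp (-x) ≤ 1 := Real.exp_le_one_iff.2 (by linarith)
      nlinarith
    set S := Real.sinh x
    have hS : 0 < S := by linarith
    have hS1 : 1 ≤ S := by linarith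
    have e1 : (2 + S ^ 2) / S ^ 3 ≤ 3 / S := by
      rw [div_le_div_iff₀ (by positivity) hS]
      have : S * 1 ≤ S * S ^ 2 := by gcongr; nlinarith
      nlinarith
    have e2 : 3 / S ≤ 12 / x ^ 2 := by
      rw [div_le_div_iff₀ hS (by positivity)]; nlinarith
    have e3 : 2 / x ^ 3 ≤ 2 / x ^ 2 := by
      exact div_le_div_of_nonneg_left (by norm_num) (by positivity)
        (pow_le_pow_right₀ h (by norm_num))
    have e4 : |(2 + S ^ 2) / S ^ 3 - 2 / x ^ 3| ≤ 14 / x ^ 2 := by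
      have p1 : 0 ≤ (2 + S ^ 2) / S ^ 3 := by positivity
      have p2 : 0 ≤ 2 / x ^ 3 := by positivity
      have p3 : 14 / x ^ 2 = 12 / x ^ 2 + 2 / x ^ 2 := by ring
      rw [abs_le]; constructor <;> linarith
    have h2 : (1 + x) ^ 2 ≤ 4 * x ^ 2 := by nlinarith
    calc _ ≤ 14 / x ^ 2 * (4 * x ^ 2) := mul_le_mul e4 h2 (by positivity) (by positivity)
      _ = 56 := by field_simp; norm_num
      _ ≤ _ := by linarith [abs_nonneg M]

lemma le_interpolation_of_deriv2_ge {f : ℝ → ℝ} (hf : ContDiff ℝ 2 f) {a b B t : ℝ} (hab : a ≤ b)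
    (hB : ∀ x ∈ Set.Icc a b, -B ≤ deriv (deriv f) x) (ht : t ∈ Set.Icc (0 : ℝ) 1) :
    f ((1 - t) * a + t * b) ≤ (1 - t) * f a + t * f b + B / 2 * (t * (1 - t) * (b - a) ^ 2) := by
  have hd : Differentiable ℝ f := hf.differentiable two_ne_zero
  have hd2 : Differentiable ℝ (deriv f) :=
    ((contDiff_succ_iff_deriv (n := 1)).1 hf).2.2.differentiable one_ne_zero
  have e1 : deriv (fun x => f x + B / 2 * x ^ 2) = fun x => deriv f x + B * x := by
    ext x
    refine (((hd x).hasDerivAt.add ((hasDerivAt_pow 2 x).const_mul (B / 2))).congr_deriv ?_).deriv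
    simp; ring
  have e2 : deriv^[2] (fun x => f x + B / 2 * x ^ 2) = fun x => deriv (deriv f) x + B := by
    simp only [Function.iterate_succ, Function.iterate_zero, Function.comp, id, e1]
    ext x
    exact (((hd2 x).hasDerivAt.add ((hasDerivAt_id x).const_mul B)).congr_deriv (by simp)).deriv
  have hconv : ConvexOn ℝ (Set.Icc a b) (fun x => f x + B / 2 * x ^ 2) := by
    refine convexOn_of_deriv2_nonneg' (convex_Icc a b) (by fun_prop) ?_ ?_
    · rw [e1]; fun_prop
    · intro x hx
      rw [e2]
      have := hB x hx
      simp only; linarith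
  have := hconv.2 (Set.left_mem_Icc.2 hab) (Set.right_mem_Icc.2 hab) (sub_nonneg.2 ht.2) ht.1
    (by ring)
  simp only [smul_eq_mul] at this
  nlinarith

/-- The error of linear interpolation of a `C²` function. -/
lemma abs_sub_interpolation_le {f : ℝ → ℝ} (hf : ContDiff ℝ 2 f) {a b B t : ℝ} (hab : a ≤ b)
    (hB : ∀ x ∈ Set.Icc a b, |deriv (deriv f) x| ≤ B) (ht : t ∈ Set.Icc (0 : ℝ) 1) :
    |f ((1 - t) * a + t * b) - ((1 - t) * f a + t * f b)| ≤ B * (b - a) ^ 2 := by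
  have hB0 : 0 ≤ B := (abs_nonneg _).trans (hB a (Set.left_mem_Icc.2 hab))
  have h1 := le_interpolation_of_deriv2_ge hf hab (fun x hx => (abs_le.1 (hB x hx)).1) ht
  have h2 := le_interpolation_of_deriv2_ge (f := fun x => -f x) hf.neg hab (B := B) (fun x hx => by
    have e : deriv (fun x => -f x) = fun x => -deriv f x := by ext y; exact deriv.fun_neg
    rw [e, deriv.fun_neg]
    linarith [(abs_le.1 (hB x hx)).2]) ht
  have h3 : B / 2 * (t * (1 - t) * (b - a) ^ 2) ≤ B * (b - a) ^ 2 := by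
    have : t * (1 - t) ≤ 1 := by nlinarith [ht.1, ht.2]
    have h4 : t * (1 - t) * (b - a) ^ 2 ≤ 1 * (b - a) ^ 2 := by gcongr
    have h5 : 0 ≤ (b - a) ^ 2 := sq_nonneg _
    have h6 : B / 2 * (t * (1 - t) * (b - a) ^ 2) ≤ B / 2 * (1 * (b - a) ^ 2) := by gcongr
    nlinarith [mul_nonneg hB0 h5]
  rw [abs_le]
  constructor <;> linarith

lemma sum_div_one_add_sq_le {s : ℝ} (hs : 0 < s) (hs1 : s ≤ 1) (M : ℕ) :
    ∑ m ∈ Finset.range M, s / (1 + m * s) ^ 2 ≤ 2 := by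
  have h : ∀ M : ℕ, ∑ m ∈ Finset.range M, s / (1 + m * s) ^ 2 ≤ 2 * (1 - 1 / (1 + M * s)) := by
    intro M
    induction M with
    | zero => simp
    | succ M ih =>
      rw [Finset.sum_range_succ]
      have hp : 0 < 1 + M * s := by positivity
      have hq : 0 < 1 + (M + 1) * s := by positivity
      have : s / (1 + M * s) ^ 2 ≤ 2 * (1 / (1 + M * s) - 1 / (1 + (M + 1) * s)) := by
        have e : 2 * (1 / (1 + M * s) - 1 / (1 + (M + 1) * s))
            = 2 * s / ((1 + M * s) * (1 + (M + 1) * s)) := by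
          field_simp; ring
        rw [e, div_le_div_iff₀ (by positivity) (by positivity)]
        have h1 : 1 + (M + 1) * s ≤ 2 * (1 + M * s) := by
          have : 0 ≤ M * s := by positivity
          linarith
        have h2 := mul_le_mul_of_nonneg_left h1 (mul_pos hs hp).le
        nlinarith
      push_cast
      linarith
  have hp : 0 < 1 / (1 + M * s) := by positivity
  linarith [h M]

/-- Shifting the sample points of a Riemann sum of `cschReg` has a second-order effect only. -/
lemma exists_abs_sum_cschReg_shift_le : ∃ K > 0, ∀ s : ℝ, 0 < s → s ≤ 1 → ∀ z ∈ Set.Icc (0 : ℝ) 1,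
    ∀ M : ℕ, |∑ m ∈ Finset.range M, s * cschReg ((m + z) * s)
      - ∑ m ∈ Finset.range M, s * cschReg ((m + 1) * s)| ≤ K * s ^ 2 + s * |cschReg (M * s)| := by
  obtain ⟨K, hK, hb⟩ := exists_bound_deriv_deriv_cschReg
  refine ⟨2 * K, by positivity, fun s hs hs1 z hz M => ?_⟩
  have hinterp : ∀ m : ℕ, |cschReg ((m + z) * s)
      - ((1 - z) * cschReg (m * s) + z * cschReg ((m + 1) * s))| ≤ K * s * (s / (1 + m * s) ^ 2) := by
    intro m
    have hms : (0 : ℝ) ≤ m * s := by positivity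
    have := abs_sub_interpolation_le (f := cschReg) contDiff_cschReg (a := m * s)
      (b := (m + 1) * s) (B := K / (1 + m * s) ^ 2) (t := z) (by nlinarith) (fun x hx => by
        refine (hb x (hms.trans hx.1)).trans ?_
        have := hx.1
        gcongr) hz
    have e : (1 - z) * (m * s) + z * ((m + 1) * s) = (m + z) * s := by ring
    rw [e] at this
    refine this.trans_eq ?_
    ring
  have htel : ∑ m ∈ Finset.range M, (cschReg ((m + 1) * s) - cschReg (m * s))
      = cschReg (M * s) := by
    have := Finset.sum_range_sub (fun m : ℕ => cschReg (m * s)) M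
    simpa [cschReg_zero] using this
  have hid : ∑ m ∈ Finset.range M, s * cschReg ((m + z) * s)
      - ∑ m ∈ Finset.range M, s * cschReg ((m + 1) * s)
      = s * ∑ m ∈ Finset.range M, (cschReg ((m + z) * s)
        - ((1 - z) * cschReg (m * s) + z * cschReg ((m + 1) * s)))
        - (1 - z) * (s * cschReg (M * s)) := by
    rw [← htel, Finset.mul_sum, Finset.mul_sum, Finset.mul_sum, ← Finset.sum_sub_distrib,
      ← Finset.sum_sub_distrib]
    exact Finset.sum_congr rfl fun m _ => by ring
  rw [hid]
  refine (abs_sub _ _).trans (add_le_add ?_ ?_)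
  · rw [abs_mul, abs_of_pos hs]
    have h1 : |∑ m ∈ Finset.range M, (cschReg ((m + z) * s)
        - ((1 - z) * cschReg (m * s) + z * cschReg ((m + 1) * s)))| ≤ K * s * 2 := by
      refine (Finset.abs_sum_le_sum_abs _ _).trans ((Finset.sum_le_sum fun m _ => hinterp m).trans ?_)
      rw [← Finset.mul_sum]
      have := sum_div_one_add_sq_le hs hs1 M
      gcongr
    nlinarith
  · rw [abs_mul, abs_mul, abs_of_pos hs, abs_of_nonneg (sub_nonneg.2 hz.2)]
    have : 0 ≤ s * |cschReg (M * s)| := by positivity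
    nlinarith [hz.1]

/-- An antiderivative of `cschReg` on the positive axis. -/
def cschRegPrim (x : ℝ) : ℝ := Real.log (sinhDiv (x / 2)) - Real.log (Real.cosh (x / 2))

lemma continuous_cschRegPrim : Continuous cschRegPrim := by
  have h : Continuous sinhDiv :=
    continuous_iff_continuousAt.2 fun x => (analyticAt_sinhDiv x).continuousAt
  unfold cschRegPrim
  refine (Continuous.log (by fun_prop) fun x => (sinhDiv_pos _).ne').sub
    (Continuous.log (by fun_prop) fun x => (Real.cosh_pos _).ne')

lemma cschRegPrim_zero : cschRegPrim 0 = 0 := by simp [cschRegPrim, sinhDiv_zero]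

lemma cschRegPrim_of_pos {x : ℝ} (hx : 0 < x) :
    cschRegPrim x = Real.log (Real.tanh (x / 2)) + Real.log 2 - Real.log x := by
  have hs : 0 < Real.sinh (x / 2) := Real.sinh_pos_iff.2 (by linarith)
  rw [cschRegPrim, sinhDiv_of_ne (by positivity), Real.tanh_eq_sinh_div_cosh,
    Real.log_div hs.ne' (by positivity), Real.log_div hs.ne' (Real.cosh_pos _).ne',
    Real.log_div hx.ne' two_ne_zero]
  ring

lemma hasDerivAt_cschRegPrim {x : ℝ} (hx : 0 < x) : HasDerivAt cschRegPrim (cschReg x) x := by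
  have hs : 0 < Real.sinh (x / 2) := Real.sinh_pos_iff.2 (by linarith)
  have hc := Real.cosh_pos (x / 2)
  have h2 : HasDerivAt (fun y : ℝ => y / 2) (1 / 2) x := (hasDerivAt_id x).div_const 2
  have h := (((h2.sinh.log hs.ne').sub (h2.cosh.log hc.ne')).add_const (Real.log 2)).sub
    (Real.hasDerivAt_log hx.ne')
  have h3 := h.congr_of_eventuallyEq (f₁ := cschRegPrim) (by
    filter_upwards [eventually_gt_nhds hx] with y hy
    have hs' : 0 < Real.sinh (y / 2) := Real.sinh_pos_iff.2 (by linarith)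
    rw [cschRegPrim_of_pos hy, Real.tanh_eq_sinh_div_cosh,
      Real.log_div hs'.ne' (Real.cosh_pos _).ne']
    simp)
  refine h3.congr_deriv ?_
  have e : Real.sinh x = 2 * Real.sinh (x / 2) * Real.cosh (x / 2) := by
    rw [← Real.sinh_two_mul]; congr 1; ring
  have hc2 := Real.cosh_sq (x / 2)
  rw [cschReg_of_ne hx.ne', e]
  field_simp
  rw [hc2]
  ring

lemma exists_abs_sum_cschReg_sub_prim_le : ∃ K > 0, ∀ s : ℝ, 0 < s → s ≤ 1 → ∀ M : ℕ,
    |∑ m ∈ Finset.range M, s * cschReg ((m + 1) * s) - cschRegPrim (M * s)|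
      ≤ K * s ^ 2 + s * |cschReg (M * s)| := by
  obtain ⟨K, hK, hb⟩ := exists_abs_sum_cschReg_shift_le
  refine ⟨K, hK, fun s hs hs1 M => ?_⟩
  have hcont := continuous_cschRegPrim
  obtain ⟨z, hz, hzeq⟩ := exists_hasDerivAt_eq_slope
    (fun z => ∑ m ∈ Finset.range M, cschRegPrim ((m + z) * s))
    (fun z => ∑ m ∈ Finset.range M, s * cschReg ((m + z) * s)) zero_lt_one
    (by fun_prop) (fun z hz => by
      refine HasDerivAt.fun_sum fun m _ => ?_
      have hz0 := hz.1
      have h1 : HasDerivAt (fun z : ℝ => (m + z) * s) s z := by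
        simpa using ((hasDerivAt_id z).const_add (m : ℝ)).mul_const s
      have := (hasDerivAt_cschRegPrim (x := (m + z) * s) (by positivity)).comp z h1
      exact this.congr_deriv (by ring))
  have htel : ∑ m ∈ Finset.range M, cschRegPrim ((m + 1) * s)
      - ∑ m ∈ Finset.range M, cschRegPrim ((m + 0) * s) = cschRegPrim (M * s) := by
    have := Finset.sum_range_sub (fun m : ℕ => cschRegPrim (m * s)) M
    rw [← Finset.sum_sub_distrib]
    simpa [cschRegPrim_zero] using this
  rw [htel, sub_zero, div_one] at hzeq
  rw [← hzeq, abs_sub_comm]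
  exact hb s hs hs1 z (Set.Ioo_subset_Icc_self hz) M

lemma hasSum_exp_mul_add {x z : ℝ} (hx : 0 < x) :
    HasSum (fun m : ℕ => Real.exp (-(x * (m + z))))
      (Real.exp (x * (1 - z)) / (Real.exp x - 1)) := by
  have h1 : Real.exp (-x) < 1 := Real.exp_lt_one_iff.2 (by linarith)
  have h := (hasSum_geometric_of_lt_one (Real.exp_pos (-x)).le h1).mul_left (Real.exp (-(x * z)))
  have h2 : 1 < Real.exp x := Real.one_lt_exp_iff.2 hx
  have e : Real.exp (x * (1 - z)) / (Real.exp x - 1)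
      = Real.exp (-(x * z)) * (1 - Real.exp (-x))⁻¹ := by
    have e1 : Real.exp (x * (1 - z)) = Real.exp (-(x * z)) * Real.exp x := by
      rw [← Real.exp_add]; congr 1; ring
    rw [e1, Real.exp_neg x, ← div_eq_mul_inv, div_eq_div_iff (by linarith)]
    · field_simp
    · rw [sub_ne_zero, ne_comm]
      exact (inv_lt_one_of_one_lt₀ h2).ne
  rw [e]
  refine h.congr_fun fun m => ?_
  rw [← Real.exp_nat_mul, ← Real.exp_add]
  congr 1; ring

lemma hasSum_exp_odd_mul {w : ℝ} (hw : 0 < w) :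
    HasSum (fun n : ℕ => Real.exp (-((2 * n + 1) * w))) (1 / (2 * Real.sinh w)) := by
  have h1 : Real.exp (-(2 * w)) < 1 := Real.exp_lt_one_iff.2 (by linarith)
  have h := (hasSum_geometric_of_lt_one (Real.exp_pos (-(2 * w))).le h1).mul_left (Real.exp (-w))
  have e : 1 / (2 * Real.sinh w) = Real.exp (-w) * (1 - Real.exp (-(2 * w)))⁻¹ := by
    have e1 : Real.exp (-(2 * w)) = Real.exp (-w) * Real.exp (-w) := by
      rw [← Real.exp_add]; congr 1; ring
    have e2 : Real.exp w * Real.exp (-w) = 1 := by rw [← Real.exp_add]; simp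
    have hs : 2 * Real.sinh w = Real.exp w - Real.exp (-w) := by rw [Real.sinh_eq]; ring
    have hs0 : 0 < Real.sinh w := Real.sinh_pos_iff.2 hw
    rw [← div_eq_mul_inv, div_eq_div_iff (by positivity) (by linarith), hs, e1]
    linear_combination -e2
  rw [e]
  refine h.congr_fun fun m => ?_
  rw [← Real.exp_nat_mul, ← Real.exp_add]
  congr 1; ring

lemma hasSum_div_sinh {s z : ℝ} (hs : 0 < s) (hz : 0 < z) :
    HasSum (fun m : ℕ => s / Real.sinh ((m + z) * s)) (2 * s * U s ((1 - z) * s)) := by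
  set f : ℕ × ℕ → ℝ := fun p => Real.exp (-((2 * p.1 + 1) * s * (p.2 + z)))
  have hsum : Summable f := by
    have h1 : Summable fun n : ℕ => Real.exp (-((2 * n + 1) * (s * z))) :=
      (hasSum_exp_odd_mul (by positivity)).summable
    have h2 : Summable fun m : ℕ => Real.exp (-(s * (m + 0))) := (hasSum_exp_mul_add hs).summable
    refine (h1.mul_of_nonneg h2 (fun _ => (Real.exp_pos _).le)
      (fun _ => (Real.exp_pos _).le)).of_nonneg_of_le (fun _ => (Real.exp_pos _).le) ?_
    rintro ⟨n, m⟩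
    simp only [f]
    rw [← Real.exp_add, Real.exp_le_exp]
    have : 0 ≤ (n : ℝ) * s * m := by positivity
    linarith
  have hrow : ∀ n : ℕ, HasSum (fun m : ℕ => f (n, m))
      (Real.exp ((2 * n + 1) * ((1 - z) * s)) / (Real.exp ((2 * n + 1) * s) - 1)) := by
    intro n
    have := hasSum_exp_mul_add (x := (2 * n + 1) * s) (z := z) (by positivity)
    rwa [show (2 * (n : ℝ) + 1) * s * (1 - z) = (2 * n + 1) * ((1 - z) * s) by ring] at this
  have hcol : ∀ m : ℕ, HasSum (fun n : ℕ => f (n, m)) (1 / (2 * Real.sinh ((m + z) * s))) := by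
    intro m
    have := hasSum_exp_odd_mul (w := (m + z) * s) (by positivity)
    convert this using 4
    ring
  have hU : HasSum f (U s ((1 - z) * s)) := by
    have := hsum.hasSum.prod_fiberwise hrow
    rw [U, this.tsum_eq]
    exact hsum.hasSum
  have hswap : HasSum (f ∘ Prod.swap) (U s ((1 - z) * s)) :=
    (Equiv.prodComm ℕ ℕ).hasSum_iff.2 hU
  have := (hswap.prod_fiberwise hcol).mul_left (2 * s)
  refine this.congr_fun ?_
  intro m
  have hs0 : 0 < Real.sinh ((m + z) * s) := Real.sinh_pos_iff.2 (by positivity)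
  field_simp

lemma abs_mul_cschReg_le {s : ℝ} (hs : 0 < s) {M : ℕ} (hM : 0 < M) :
    s * |cschReg (M * s)| ≤ 1 / M := by
  have hx : 0 < M * s := by positivity
  have h1 : M * s ≤ Real.sinh (M * s) := Real.self_le_sinh_iff.2 hx.le
  have h2 : 1 / Real.sinh (M * s) ≤ 1 / (M * s) := one_div_le_one_div_of_le hx h1
  have h3 : 0 ≤ 1 / Real.sinh (M * s) := by positivity
  have h4 : |cschReg (M * s)| ≤ 1 / (M * s) := by
    rw [cschReg_of_ne hx.ne', abs_le]
    constructor <;> linarith [one_div_pos.2 hx]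
  calc s * |cschReg (M * s)| ≤ s * (1 / (M * s)) := by gcongr
    _ = 1 / M := by field_simp

/-- Limit version of an `s * |cschReg (M * s)|` error bound. -/
lemma abs_le_of_tendsto_cschReg {s K L : ℝ} (hs : 0 < s) {u : ℕ → ℝ} (hu : Tendsto u atTop (𝓝 L))
    (h : ∀ M > 0, |u M| ≤ K + s * |cschReg (M * s)|) : |L| ≤ K := by
  have h1 : Tendsto (fun M : ℕ => K + 1 / (M : ℝ)) atTop (𝓝 (K + 0)) :=
    tendsto_const_nhds.add tendsto_one_div_atTop_nhds_zero_nat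
  rw [add_zero] at h1
  refine le_of_tendsto_of_tendsto hu.abs h1 ?_
  filter_upwards [eventually_gt_atTop 0] with M hM
  linarith [h M hM, abs_mul_cschReg_le hs hM]

lemma div_sinh_eq {s x : ℝ} (hs : 0 < s) (hx : 0 < x) :
    s / Real.sinh (x * s) = s * cschReg (x * s) + 1 / x := by
  have h : x * s ≠ 0 := by positivity
  rw [cschReg_of_ne h]
  field_simp
  ring

lemma sum_div_sinh_eq {s x : ℝ} (hs : 0 < s) (hx : 0 < x) (M : ℕ) :
    ∑ m ∈ Finset.range M, s / Real.sinh ((m + x) * s)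
      = ∑ m ∈ Finset.range M, s * cschReg ((m + x) * s)
        + ∑ m ∈ Finset.range M, 1 / (m + x) := by
  rw [← Finset.sum_add_distrib]
  exact Finset.sum_congr rfl fun m _ => div_sinh_eq hs (by positivity)

lemma tendsto_tanh_atTop : Tendsto Real.tanh atTop (𝓝 1) := by
  have h0 : Tendsto (fun x : ℝ => Real.exp (-(2 * x))) atTop (𝓝 0) :=
    Real.tendsto_exp_neg_atTop_nhds_zero.comp (tendsto_id.const_mul_atTop two_pos)
  have h := (h0.const_sub 1).div (h0.const_add 1) (by norm_num)
  rw [sub_zero, add_zero, div_one] at h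
  refine h.congr fun x => ?_
  have e : Real.exp (-(2 * x)) = Real.exp (-x) * Real.exp (-x) := by
    rw [← Real.exp_add]; congr 1; ring
  have e2 : Real.exp x * Real.exp (-x) = 1 := by rw [← Real.exp_add]; simp
  have p1 := Real.exp_pos x
  have p2 := Real.exp_pos (-x)
  simp only [Pi.div_apply]
  rw [Real.tanh_eq, e, div_eq_div_iff (by positivity) (by positivity)]
  linear_combination (-2 * Real.exp (-x)) * e2

lemma exists_abs_U_zero_sub_le : ∃ K > 0, ∀ s : ℝ, 0 < s → s ≤ 1 →
    |2 * s * U s 0 - (Real.log (2 / s) + Real.eulerMascheroniConstant)| ≤ K * s ^ 2 := by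
  obtain ⟨K, hK, hb⟩ := exists_abs_sum_cschReg_sub_prim_le
  refine ⟨K, hK, fun s hs hs1 => ?_⟩
  have h1 := (hasSum_div_sinh (z := 1) hs one_pos).tendsto_sum_nat
  simp only [sub_self, zero_mul] at h1
  have hMs : Tendsto (fun M : ℕ => (M : ℝ) * s / 2) atTop atTop :=
    (tendsto_natCast_atTop_atTop.atTop_mul_const hs).atTop_div_const two_pos
  have htanh : Tendsto (fun M : ℕ => Real.log (Real.tanh (M * s / 2))) atTop (𝓝 0) := by
    have h := (tendsto_tanh_atTop.comp hMs).log one_ne_zero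
    simpa using h
  have hlim := ((h1.sub Real.tendsto_harmonic_sub_log).sub htanh).sub
    (tendsto_const_nhds (x := Real.log (2 / s)))
  have := abs_le_of_tendsto_cschReg hs (K := K * s ^ 2) hlim (fun M hM => by
    refine le_of_eq_of_le ?_ (hb s hs hs1 M)
    have hM' : (0 : ℝ) < M := by exact_mod_cast hM
    rw [cschRegPrim_of_pos (by positivity), Real.log_mul hM'.ne' hs.ne',
      Real.log_div two_ne_zero hs.ne', sum_div_sinh_eq hs one_pos]
    have : ((harmonic M : ℚ) : ℝ) = ∑ m ∈ Finset.range M, 1 / ((m : ℝ) + 1) := by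
      simp [harmonic]
    rw [this]
    congr 1
    ring)
  refine le_of_eq_of_le ?_ this
  congr 1
  ring

lemma summable_div_mul_add {z w : ℝ} (hz : 0 < z) (hw : 0 < w) (c : ℝ) :
    Summable fun k : ℕ => c / ((k + z) * (k + w)) := by
  have h : Summable fun k : ℕ => 1 / |(k : ℝ) + min z w| ^ (2 : ℝ) :=
    (Real.summable_one_div_nat_add_rpow _ 2).2 one_lt_two
  refine Summable.of_norm_bounded (h.mul_left |c|) fun k => ?_
  have hm : 0 < min z w := lt_min hz hw
  have h1 := min_le_left z w
  have h2 := min_le_right z w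
  rw [norm_div, Real.norm_eq_abs, Real.norm_eq_abs, abs_of_pos (by positivity : 0 < (k + z) * (k + w)),
    abs_of_pos (by positivity : (0 : ℝ) < k + min z w), Real.rpow_two, sq, mul_one_div]
  have h3 : 0 < k + min z w := by positivity
  gcongr

lemma hasSum_digammaVal {z : ℝ} (hz : 0 < z) :
    HasSum (fun k : ℕ => 1 / (k + z) - 1 / (k + 1))
      (-(digammaVal z + Real.eulerMascheroniConstant)) := by
  have h := (summable_div_mul_add one_pos hz (z - 1)).hasSum.neg
  have e : -(digammaVal z + Real.eulerMascheroniConstant)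
      = -∑' k : ℕ, (z - 1) / ((k + 1) * (k + z)) := by
    rw [digammaVal]; ring
  rw [e]
  refine h.congr_fun fun k => ?_
  have : (0 : ℝ) < k + z := by positivity
  field_simp
  ring

lemma exists_abs_U_sub_U_zero_le : ∃ K > 0, ∀ s : ℝ, 0 < s → s ≤ 1 → ∀ z : ℝ, 0 < z → z ≤ 1 →
    |2 * s * U s ((1 - z) * s) - 2 * s * U s 0
      + (digammaVal z + Real.eulerMascheroniConstant)| ≤ K * s ^ 2 := by
  obtain ⟨K, hK, hb⟩ := exists_abs_sum_cschReg_shift_le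
  refine ⟨K, hK, fun s hs hs1 z hz hz1 => ?_⟩
  have h1 := (hasSum_div_sinh (z := 1) hs one_pos).tendsto_sum_nat
  simp only [sub_self, zero_mul] at h1
  have hlim := ((hasSum_div_sinh hs hz).tendsto_sum_nat.sub h1).sub
    (hasSum_digammaVal hz).tendsto_sum_nat
  have := abs_le_of_tendsto_cschReg hs (K := K * s ^ 2) hlim (fun M hM => by
    refine le_of_eq_of_le ?_ (hb s hs hs1 z ⟨hz.le, hz1⟩ M)
    rw [sum_div_sinh_eq hs one_pos, sum_div_sinh_eq hs hz, Finset.sum_sub_distrib]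
    congr 1
    ring)
  rwa [sub_neg_eq_add] at this

lemma digammaVal_add_lt_zero {z : ℝ} (hz : 0 < z) (hz1 : z < 1) :
    digammaVal z + Real.eulerMascheroniConstant < 0 := by
  have h := hasSum_digammaVal hz
  have hpos : ∀ k : ℕ, 0 < 1 / ((k : ℝ) + z) - 1 / (k + 1) := fun k =>
    sub_pos.2 (one_div_lt_one_div_of_lt (by positivity) (by linarith))
  have := h.summable.tsum_pos (fun k => (hpos k).le) 0 (hpos 0)
  rw [h.tsum_eq] at this
  linarith

lemma abs_digammaVal_sub_le {δ z w : ℝ} (hδ : 0 < δ) (hz : δ ≤ z) (hw : δ ≤ w) :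
    |digammaVal z - digammaVal w| ≤ |z - w| * ∑' k : ℕ, 1 / ((k + δ) * (k + δ)) := by
  have hz0 := hδ.trans_le hz
  have hw0 := hδ.trans_le hw
  have h := (hasSum_digammaVal hw0).sub (hasSum_digammaVal hz0)
  have hd := (summable_div_mul_add hδ hδ 1).hasSum.mul_left |z - w|
  have := h.norm_le_of_bounded hd (fun k => by
    have e : 1 / ((k : ℝ) + w) - 1 / (k + 1) - (1 / (k + z) - 1 / (k + 1))
        = (z - w) / ((k + z) * (k + w)) := by
      field_simp; ring
    rw [e, Real.norm_eq_abs, abs_div, abs_of_pos (by positivity : 0 < (k + z) * (k + w)),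
      mul_one_div]
    gcongr)
  rw [Real.norm_eq_abs] at this
  convert this using 2
  ring

/-- `u ε = c + O(ε)` as `ε` decreases to `0`. -/
def LinApprox (u : ℝ → ℝ) (c : ℝ) : Prop :=
  (fun ε => u ε - c) =O[𝓝[>] 0] fun ε : ℝ => ε

namespace LinApprox

variable {u v : ℝ → ℝ} {c d : ℝ}

lemma tendsto (h : LinApprox u c) : Tendsto u (𝓝[>] 0) (𝓝 c) := by
  have h0 : Tendsto (fun ε : ℝ => ε) (𝓝[>] 0) (𝓝 0) := tendsto_id.mono_left nhdsWithin_le_nhds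
  simpa using (IsBigO.trans_tendsto h h0).add_const c

lemma comp {φ : ℝ → ℝ} (h : LinApprox u c) (hφ : DifferentiableAt ℝ φ c) :
    LinApprox (fun ε => φ (u ε)) (φ c) :=
  (hφ.isBigO_sub.comp_tendsto h.tendsto).trans h

lemma id' : LinApprox (fun ε => ε) 0 := by
  simpa [LinApprox] using isBigO_refl (fun ε : ℝ => ε) (𝓝[>] 0)

lemma congr' (h : LinApprox u c) (huv : u =ᶠ[𝓝[>] 0] v) : LinApprox v c :=
  IsBigO.congr' h (huv.mono fun ε hε => by simp only [hε]) EventuallyEq.rfl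

lemma add (h : LinApprox u c) (h' : LinApprox v d) : LinApprox (fun ε => u ε + v ε) (c + d) :=
  (IsBigO.add h h').congr_left fun ε => by ring

lemma mul (h : LinApprox u c) (h' : LinApprox v d) : LinApprox (fun ε => u ε * v ε) (c * d) := by
  have h1 : (fun ε => (u ε - c) * v ε) =O[𝓝[>] 0] fun ε : ℝ => ε * 1 :=
    IsBigO.mul h (h'.tendsto.isBigO_one ℝ)
  have h2 := IsBigO.const_mul_left h' c
  simp only [mul_one] at h1
  exact (h1.add h2).congr_left fun ε => by ring

lemma div (h : LinApprox u c) (h' : LinApprox v d) (hd : d ≠ 0) :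
    LinApprox (fun ε => u ε / v ε) (c / d) := by
  simp only [div_eq_mul_inv]
  exact h.mul (h'.comp (differentiableAt_inv hd))

end LinApprox

lemma isBigO_arsinh_div_sub_one :
    (fun y => Real.arsinh y / y - 1) =O[𝓝[≠] 0] fun y : ℝ => y ^ 2 := by
  have ha : Real.arsinh =O[𝓝 0] fun y : ℝ => y := by
    simpa using Real.differentiable_arsinh.differentiableAt.isBigO_sub (x₀ := (0 : ℝ))
  have hg : cschReg =O[𝓝 0] fun x : ℝ => x := by
    simpa [cschReg_zero] using
      (analyticAt_cschReg 0).differentiableAt.isBigO_sub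
  have hlim : Tendsto Real.arsinh (𝓝 0) (𝓝 0) := by
    simpa using Real.continuous_arsinh.tendsto 0
  have h := (ha.mul ((hg.comp_tendsto hlim).trans ha)).mono (nhdsWithin_le_nhds (s := {(0 : ℝ)}ᶜ))
  refine h.congr' ?_ (Eventually.of_forall fun y => (sq y).symm)
  filter_upwards [self_mem_nhdsWithin] with y hy
  have hy : y ≠ 0 := hy
  have hx : Real.arsinh y ≠ 0 := fun h => hy (Real.arsinh_eq_zero_iff.1 h)
  simp only [Function.comp]
  rw [cschReg_of_ne hx, Real.sinh_arsinh]
  field_simp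

lemma isBigO_sq_of_linApprox {s : ℝ → ℝ} {c : ℝ} (hs2 : LinApprox (fun ε => s ε ^ 2 / ε) c) :
    (fun ε => s ε ^ 2) =O[𝓝[>] 0] fun ε : ℝ => ε := by
  have h := (hs2.tendsto.isBigO_one ℝ).mul (isBigO_refl (fun ε : ℝ => ε) (𝓝[>] 0))
  simp only [one_mul] at h
  refine h.congr' ?_ EventuallyEq.rfl
  filter_upwards [self_mem_nhdsWithin] with ε hε
  have hε : 0 < ε := hε
  field_simp

section Geometry

variable {r₁ r₂ : ℝ}

lemma aEps_pos (hr₁ : 0 < r₁) (hr₂ : 0 < r₂) {ε : ℝ} (hε : 0 < ε) : 0 < aEps r₁ r₂ ε := by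
  unfold aEps; positivity

lemma linApprox_aEps_sq_div (hr₁ : 0 < r₁) (hr₂ : 0 < r₂) :
    LinApprox (fun ε => aEps r₁ r₂ ε ^ 2 / ε) (2 * rTilde r₁ r₂) := by
  have h := LinApprox.id'.comp (φ := fun ε =>
    (2 * r₁ + ε) * (2 * r₂ + ε) * (2 * r₁ + 2 * r₂ + ε) / (4 * (r₁ + r₂ + ε) ^ 2)) (by
      refine DifferentiableAt.div (by fun_prop) (by fun_prop) ?_
      positivity)
  have e : (2 * r₁ + 0) * (2 * r₂ + 0) * (2 * r₁ + 2 * r₂ + 0) / (4 * (r₁ + r₂ + 0) ^ 2)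
      = 2 * rTilde r₁ r₂ := by
    rw [rTilde]; field_simp; ring
  rw [← e]
  refine h.congr' ?_
  filter_upwards [self_mem_nhdsWithin] with ε hε
  have hε : 0 < ε := hε
  rw [aEps, div_pow, mul_pow, Real.sq_sqrt hε.le, Real.sq_sqrt (by positivity)]
  field_simp
  norm_num

lemma isBigO_aEps_sq (hr₁ : 0 < r₁) (hr₂ : 0 < r₂) :
    (fun ε => aEps r₁ r₂ ε ^ 2) =O[𝓝[>] 0] fun ε : ℝ => ε :=
  isBigO_sq_of_linApprox (linApprox_aEps_sq_div hr₁ hr₂)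

lemma tendsto_zero_of_sq_isBigO {u : ℝ → ℝ} (h : (fun ε => u ε ^ 2) =O[𝓝[>] 0] fun ε : ℝ => ε) :
    Tendsto u (𝓝[>] 0) (𝓝 0) := by
  have h0 : Tendsto (fun ε : ℝ => ε) (𝓝[>] 0) (𝓝 0) := tendsto_id.mono_left nhdsWithin_le_nhds
  have h1 := (h.trans_tendsto h0).sqrt
  simp only [Real.sqrt_sq_eq_abs, Real.sqrt_zero] at h1
  exact (tendsto_zero_iff_abs_tendsto_zero _).2 h1

lemma linApprox_xi_div_aEps (hr₁ : 0 < r₁) (hr₂ : 0 < r₂) {r : ℝ} (hr : 0 < r) :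
    LinApprox (fun ε => xi r r₁ r₂ ε / aEps r₁ r₂ ε) (1 / r) := by
  have ha := isBigO_aEps_sq hr₁ hr₂
  have hlim : Tendsto (fun ε => aEps r₁ r₂ ε / r) (𝓝[>] 0) (𝓝[≠] 0) := by
    refine tendsto_nhdsWithin_iff.2 ⟨by simpa using (tendsto_zero_of_sq_isBigO ha).div_const r, ?_⟩
    filter_upwards [self_mem_nhdsWithin] with ε hε
    exact (div_pos (aEps_pos hr₁ hr₂ hε) hr).ne'
  have h1 := isBigO_arsinh_div_sub_one.comp_tendsto hlim
  have h2 : ((fun y : ℝ => y ^ 2) ∘ fun ε => aEps r₁ r₂ ε / r) =O[𝓝[>] 0] fun ε : ℝ => ε :=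
    (ha.const_mul_left (1 / r ^ 2)).congr_left fun ε => by simp only [Function.comp]; ring
  refine ((h1.trans h2).const_mul_left (1 / r)).congr' ?_ EventuallyEq.rfl
  filter_upwards [self_mem_nhdsWithin] with ε hε
  have := aEps_pos hr₁ hr₂ hε
  simp only [Function.comp, xi]
  field_simp

lemma xi_pos (hr₁ : 0 < r₁) (hr₂ : 0 < r₂) {r ε : ℝ} (hr : 0 < r) (hε : 0 < ε) :
    0 < xi r r₁ r₂ ε :=
  Real.arsinh_pos_iff.2 (div_pos (aEps_pos hr₁ hr₂ hε) hr)

end Geometry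

lemma linApprox_U_zero {s : ℝ → ℝ} {c : ℝ} (hc : 0 < c) (hpos : ∀ᶠ ε in 𝓝[>] 0, 0 < s ε)
    (hs2 : LinApprox (fun ε => s ε ^ 2 / ε) c) :
    LinApprox (fun ε => 2 * s ε * U (s ε) 0 - |Real.log ε| / 2)
      (Real.log 2 - Real.log c / 2 + Real.eulerMascheroniConstant) := by
  obtain ⟨K, hK, hb⟩ := exists_abs_U_zero_sub_le
  have hO := isBigO_sq_of_linApprox hs2
  have hlim := tendsto_zero_of_sq_isBigO hO
  have h1 : LinApprox (fun ε => 2 * s ε * U (s ε) 0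
      - (Real.log (2 / s ε) + Real.eulerMascheroniConstant)) 0 := by
    refine IsBigO.trans (IsBigO.of_bound K ?_) hO
    filter_upwards [hpos, hlim.eventually_le_const one_pos] with ε h1 h2
    rw [sub_zero, Real.norm_eq_abs, Real.norm_eq_abs, abs_of_nonneg (sq_nonneg (s ε))]
    exact hb _ h1 h2
  have h2 := h1.add (hs2.comp (φ := fun x => Real.log 2 - Real.log x / 2
    + Real.eulerMascheroniConstant)
    (((Real.differentiableAt_log hc.ne').div_const 2).const_sub _ |>.add_const _))
  rw [zero_add] at h2
  refine h2.congr' ?_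
  filter_upwards [hpos, Ioo_mem_nhdsGT one_pos] with ε h1 h2
  rw [abs_of_neg (Real.log_neg h2.1 h2.2), Real.log_div two_ne_zero h1.ne',
    Real.log_div (pow_ne_zero 2 h1.ne') h2.1.ne', Real.log_pow]
  push_cast
  ring

lemma linApprox_U_sub_U_zero {s z : ℝ → ℝ} {z₀ : ℝ} (hz₀ : z₀ ∈ Set.Ioo (0 : ℝ) 1)
    (hpos : ∀ᶠ ε in 𝓝[>] 0, 0 < s ε) (hO : (fun ε => s ε ^ 2) =O[𝓝[>] 0] fun ε : ℝ => ε)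
    (hz : LinApprox z z₀) :
    LinApprox (fun ε => 2 * s ε * U (s ε) ((1 - z ε) * s ε) - 2 * s ε * U (s ε) 0)
      (-(digammaVal z₀ + Real.eulerMascheroniConstant)) := by
  obtain ⟨K, hK, hb⟩ := exists_abs_U_sub_U_zero_le
  have hlim := tendsto_zero_of_sq_isBigO hO
  have hzlim := hz.tendsto
  have hδ : z₀ / 2 < z₀ := by linarith [hz₀.1]
  have h1 : LinApprox (fun ε => 2 * s ε * U (s ε) ((1 - z ε) * s ε) - 2 * s ε * U (s ε) 0
      + (digammaVal (z ε) + Real.eulerMascheroniConstant)) 0 := by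
    refine IsBigO.trans (IsBigO.of_bound K ?_) hO
    filter_upwards [hpos, hlim.eventually_le_const one_pos, hzlim.eventually_le_const hz₀.2,
      hzlim.eventually_const_lt hz₀.1] with ε h1 h2 h3 h4
    rw [sub_zero, Real.norm_eq_abs, Real.norm_eq_abs, abs_of_nonneg (sq_nonneg (s ε))]
    exact hb _ h1 h2 _ h4 h3
  have h2 : LinApprox (fun ε => digammaVal (z ε)) (digammaVal z₀) := by
    refine IsBigO.trans (IsBigO.of_bound
      (∑' k : ℕ, 1 / (((k : ℝ) + z₀ / 2) * (k + z₀ / 2))) ?_) hz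
    filter_upwards [hzlim.eventually_const_le hδ] with ε h
    rw [Real.norm_eq_abs, Real.norm_eq_abs, mul_comm]
    exact abs_digammaVal_sub_le (by linarith [hz₀.1]) h hδ.le
  exact (IsBigO.sub h1 h2).congr_left fun ε => by ring

/-- Passing to reciprocals of quantities that tend to infinity preserves `O(ε)` closeness. -/
lemma isBigO_mul_inv_sub {A Y Y₀ : ℝ → ℝ} {A₀ : ℝ} (hA : LinApprox A A₀)
    (hY : LinApprox (fun ε => Y ε - Y₀ ε) 0) (hY₀ : Tendsto Y₀ (𝓝[>] 0) atTop) :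
    (fun ε => A ε * (Y ε)⁻¹ - A₀ * (Y₀ ε)⁻¹) =O[𝓝[>] 0] fun ε : ℝ => ε := by
  have hYlim : Tendsto Y (𝓝[>] 0) atTop := by
    have := hY.tendsto.add_atTop hY₀
    simpa using this
  have hi := (tendsto_inv_atTop_zero.comp hYlim).isBigO_one ℝ
  have hi₀ := (tendsto_inv_atTop_zero.comp hY₀).isBigO_one ℝ
  have h1 := IsBigO.mul hA hi
  have h2 := ((IsBigO.mul (IsBigO.mul hY hi) hi₀).const_mul_left (-A₀))
  simp only [mul_one] at h1 h2
  refine (h1.add h2).congr' ?_ EventuallyEq.rfl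
  filter_upwards [hYlim.eventually_gt_atTop 0, hY₀.eventually_gt_atTop 0] with ε p q
  simp only [Function.comp]
  field_simp
  ring

section MainTerms

variable {r₁ r₂ : ℝ}

lemma linApprox_xi_sum_div_aEps (hr₁ : 0 < r₁) (hr₂ : 0 < r₂) :
    LinApprox (fun ε => (xi r₁ r₁ r₂ ε + xi r₂ r₁ r₂ ε) / aEps r₁ r₂ ε) (1 / rTilde r₁ r₂) := by
  have h := (linApprox_xi_div_aEps hr₁ hr₂ hr₁).add (linApprox_xi_div_aEps hr₁ hr₂ hr₂)
  have e : 1 / r₁ + 1 / r₂ = 1 / rTilde r₁ r₂ := by rw [rTilde]; field_simp; ring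
  rw [e] at h
  exact h.congr' (Eventually.of_forall fun ε => (add_div _ _ _).symm)

lemma linApprox_xi_sum_sq_div (hr₁ : 0 < r₁) (hr₂ : 0 < r₂) :
    LinApprox (fun ε => (xi r₁ r₁ r₂ ε + xi r₂ r₁ r₂ ε) ^ 2 / ε) (2 / rTilde r₁ r₂) := by
  have hs := linApprox_xi_sum_div_aEps hr₁ hr₂
  have h := (hs.mul hs).mul (linApprox_aEps_sq_div hr₁ hr₂)
  have ht : 0 < rTilde r₁ r₂ := by unfold rTilde; positivity
  have e : 1 / rTilde r₁ r₂ * (1 / rTilde r₁ r₂) * (2 * rTilde r₁ r₂) = 2 / rTilde r₁ r₂ := by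
    field_simp
  rw [e] at h
  refine h.congr' ?_
  filter_upwards [self_mem_nhdsWithin] with ε hε
  have := aEps_pos hr₁ hr₂ hε
  field_simp

lemma eventually_xi_sum_pos (hr₁ : 0 < r₁) (hr₂ : 0 < r₂) :
    ∀ᶠ ε in 𝓝[>] 0, 0 < xi r₁ r₁ r₂ ε + xi r₂ r₁ r₂ ε := by
  filter_upwards [self_mem_nhdsWithin] with ε hε
  exact add_pos (xi_pos hr₁ hr₂ hr₁ hε) (xi_pos hr₁ hr₂ hr₂ hε)

/-- The difference `2 s₀ (U(s₀ - ξ) - U(0))`, where `ξ` belongs to the radius `r`. -/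
lemma linApprox_U_sub_U_zero_xi (hr₁ : 0 < r₁) (hr₂ : 0 < r₂) {r : ℝ} (hr : 0 < r)
    (hrt : rTilde r₁ r₂ < r) :
    LinApprox (fun ε => 2 * (xi r₁ r₁ r₂ ε + xi r₂ r₁ r₂ ε)
        * U (xi r₁ r₁ r₂ ε + xi r₂ r₁ r₂ ε) (xi r₁ r₁ r₂ ε + xi r₂ r₁ r₂ ε - xi r r₁ r₂ ε)
      - 2 * (xi r₁ r₁ r₂ ε + xi r₂ r₁ r₂ ε) * U (xi r₁ r₁ r₂ ε + xi r₂ r₁ r₂ ε) 0)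
      (-(digammaVal (rTilde r₁ r₂ / r) + Real.eulerMascheroniConstant)) := by
  have ht : 0 < rTilde r₁ r₂ := by unfold rTilde; positivity
  have hz := (linApprox_xi_div_aEps hr₁ hr₂ hr).div (linApprox_xi_sum_div_aEps hr₁ hr₂)
    (by positivity)
  have e : 1 / r / (1 / rTilde r₁ r₂) = rTilde r₁ r₂ / r := by field_simp
  rw [e] at hz
  refine (linApprox_U_sub_U_zero ⟨by positivity, (div_lt_one hr).2 hrt⟩
    (eventually_xi_sum_pos hr₁ hr₂) (isBigO_sq_of_linApprox (linApprox_xi_sum_sq_div hr₁ hr₂))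
    hz).congr' ?_
  filter_upwards [self_mem_nhdsWithin, eventually_xi_sum_pos hr₁ hr₂] with ε hε hs
  have ha := aEps_pos hr₁ hr₂ hε
  congr 3
  field_simp

/-- The asymptotics of `Cconst`, with the sign removed and the index encoded by the factor `E`. -/
lemma isBigO_ratio_sub {s a W E₁ E₂ E L : ℝ → ℝ} {σ k D₁ D₂ D : ℝ}
    (hsa : LinApprox (fun ε => s ε / a ε) σ) (hW : LinApprox (fun ε => W ε - L ε) k)
    (h₁ : LinApprox E₁ D₁) (h₂ : LinApprox E₂ D₂) (hE : LinApprox E D)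
    (hD : 0 < D₁ + D₂) (hL : Tendsto L (𝓝[>] 0) atTop) :
    (fun ε => s ε / a ε * (E ε / (W ε * (E₁ ε + E₂ ε) + E₁ ε * E₂ ε))
      - σ * (D / (D₁ + D₂)) * (L ε + (k + D₁ * D₂ / (D₁ + D₂)))⁻¹) =O[𝓝[>] 0]
        fun ε : ℝ => ε := by
  have hsum := h₁.add h₂
  have hA := hsa.mul (hE.div hsum hD.ne')
  have hY := hW.add ((h₁.mul h₂).div hsum hD.ne')
  have hYlim := hY.tendsto.add_atTop hL
  refine (isBigO_mul_inv_sub (Y := fun ε => W ε + E₁ ε * E₂ ε / (E₁ ε + E₂ ε))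
    (Y₀ := fun ε => L ε + (k + D₁ * D₂ / (D₁ + D₂))) hA
    (IsBigO.congr_left hY fun ε => by ring) (tendsto_atTop_add_const_right _ _ hL)).congr'
    ?_ EventuallyEq.rfl
  filter_upwards [hsum.tendsto.eventually_const_lt hD, hYlim.eventually_gt_atTop 0] with ε h3 h4
  have e : W ε * (E₁ ε + E₂ ε) + E₁ ε * E₂ ε
      = (E₁ ε + E₂ ε) * (W ε + E₁ ε * E₂ ε / (E₁ ε + E₂ ε)) := by field_simp
  rw [e]
  congr 1
  rw [← div_div]
  ring

lemma isBigO_Cconst_sub (hr₁ : 0 < r₁) (hr₂ : 0 < r₂) (j : ℕ) :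
    (fun ε => Cconst r₁ r₂ ε j - (-1) ^ j * muEps r₁ r₂ ε * muConst r₁ r₂ j) =O[𝓝[>] 0]
      fun ε : ℝ => ε := by
  have ht : 0 < rTilde r₁ r₂ := by unfold rTilde; positivity
  have ht₁ : rTilde r₁ r₂ < r₁ := by
    rw [rTilde, div_lt_iff₀ (by positivity)]; nlinarith
  have ht₂ : rTilde r₁ r₂ < r₂ := by
    rw [rTilde, div_lt_iff₀ (by positivity)]; nlinarith
  have q₁ : rTilde r₁ r₂ / r₂ = r₁ / (r₁ + r₂) := by rw [rTilde]; field_simp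
  have q₂ : rTilde r₁ r₂ / r₁ = r₂ / (r₁ + r₂) := by rw [rTilde]; field_simp
  have h₁ := linApprox_U_sub_U_zero_xi hr₁ hr₂ hr₂ ht₂
  have h₂ := linApprox_U_sub_U_zero_xi hr₁ hr₂ hr₁ ht₁
  simp only [add_sub_cancel_left, add_sub_cancel_right] at h₁ h₂
  have g₁ := digammaVal_add_lt_zero (z := rTilde r₁ r₂ / r₂) (by positivity)
    ((div_lt_one hr₂).2 ht₂)
  have g₂ := digammaVal_add_lt_zero (z := rTilde r₁ r₂ / r₁) (by positivity)
    ((div_lt_one hr₁).2 ht₁)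
  rw [q₁] at h₁ g₁
  rw [q₂] at h₂ g₂
  have hpos := eventually_xi_sum_pos hr₁ hr₂
  have hW := linApprox_U_zero (by positivity) hpos (linApprox_xi_sum_sq_div hr₁ hr₂)
  have hL : Tendsto (fun ε : ℝ => |Real.log ε| / 2) (𝓝[>] 0) atTop :=
    (tendsto_abs_atBot_atTop.comp Real.tendsto_log_nhdsGT_zero).atTop_div_const two_pos
  have key : ∀ {r : ℝ} {D : ℝ}, LinApprox (fun ε => 2 * (xi r₁ r₁ r₂ ε + xi r₂ r₁ r₂ ε)
        * U (xi r₁ r₁ r₂ ε + xi r₂ r₁ r₂ ε) (xi r r₁ r₂ ε)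
      - 2 * (xi r₁ r₁ r₂ ε + xi r₂ r₁ r₂ ε) * U (xi r₁ r₁ r₂ ε + xi r₂ r₁ r₂ ε) 0) D → _ :=
    fun {r D} h => (isBigO_ratio_sub (linApprox_xi_sum_div_aEps hr₁ hr₂) hW h₁ h₂ h
      (by linarith) hL).const_mul_left ((-1) ^ j / (4 * Real.pi))
  have hlog : Real.log (2 / rTilde r₁ r₂) = Real.log 2 - Real.log (rTilde r₁ r₂) :=
    Real.log_div two_ne_zero ht.ne'
  have hr : LinApprox (fun ε => 2 * (xi r₁ r₁ r₂ ε + xi r₂ r₁ r₂ ε)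
        * U (xi r₁ r₁ r₂ ε + xi r₂ r₁ r₂ ε) (xi (if j = 1 then r₁ else r₂) r₁ r₂ ε)
      - 2 * (xi r₁ r₁ r₂ ε + xi r₂ r₁ r₂ ε) * U (xi r₁ r₁ r₂ ε + xi r₂ r₁ r₂ ε) 0)
      (-(digammaVal ((if j = 1 then r₁ else r₂) / (r₁ + r₂))
        + Real.eulerMascheroniConstant)) := by
    split_ifs
    exacts [h₁, h₂]
  refine (key hr).congr' ?_ EventuallyEq.rfl
  filter_upwards [self_mem_nhdsWithin, hpos] with ε hε hs
  have ha := aEps_pos hr₁ hr₂ hε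
  rw [mul_sub]
  congr 1
  · rw [Cconst]
    generalize U _ (xi (if j = 1 then r₁ else r₂) r₁ r₂ ε) = u
    generalize U _ (xi r₁ r₁ r₂ ε) = u₁
    generalize U _ (xi r₂ r₁ r₂ ε) = u₂
    generalize U _ 0 = u₀
    generalize xi r₁ r₁ r₂ ε + xi r₂ r₁ r₂ ε = s at hs ⊢
    have e1 : 2 * s * u - 2 * s * u₀ = 2 * s * (u - u₀) := by ring
    have e2 : 2 * s * u₀ * (2 * s * u₁ - 2 * s * u₀ + (2 * s * u₂ - 2 * s * u₀))
        + (2 * s * u₁ - 2 * s * u₀) * (2 * s * u₂ - 2 * s * u₀)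
        = 2 * s * (2 * s) * (u₁ * u₂ - u₀ ^ 2) := by ring
    rw [e1, e2, mul_assoc (2 * s), mul_div_mul_left _ _ (by positivity)]
    generalize hv : (u₁ * u₂ - u₀ ^ 2) = v
    rcases eq_or_ne v 0 with rfl | hv0
    · simp
    · field_simp
      ring
  · rw [muEps, muConst, hlog]
    generalize digammaVal ((if j = 1 then r₁ else r₂) / (r₁ + r₂)) = d
    generalize digammaVal (r₁ / (r₁ + r₂)) = d₁ at g₁ g₂ ⊢
    generalize digammaVal (r₂ / (r₁ + r₂)) = d₂ at g₁ g₂ ⊢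
    generalize Real.eulerMascheroniConstant = γ at g₁ g₂ ⊢
    have hS : d₁ + d₂ + 2 * γ ≠ 0 := by linarith
    have e1 : -(d₁ + γ) + -(d₂ + γ) = -(d₁ + d₂ + 2 * γ) := by ring
    have e2 : |Real.log ε| + Real.log (rTilde r₁ r₂) + Real.log 2
        - 2 * (d₁ * d₂ - γ ^ 2) / (d₁ + d₂ + 2 * γ)
        = 2 * (|Real.log ε| / 2 + (Real.log 2 - (Real.log 2 - Real.log (rTilde r₁ r₂)) / 2 + γ
          + -(d₁ + γ) * -(d₂ + γ) / -(d₁ + d₂ + 2 * γ))) := by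
      field_simp
      ring
    rw [e1, e2, mul_inv]
    rw [neg_div_neg_eq]
    field_simp
    ring

end MainTerms

theorem stmt5 (r₁ r₂ : ℝ) (hr₁ : 0 < r₁) (hr₂ : 0 < r₂) :
    ∃ C > 0, ∃ ε₀ > 0, ∀ ε ∈ Set.Ioo 0 ε₀, ∀ j ∈ ({1, 2} : Set ℕ),
      |Cconst r₁ r₂ ε j - (-1) ^ j * muEps r₁ r₂ ε * muConst r₁ r₂ j| ≤ C * ε := by
  have hb : ∀ j : ℕ, ∃ C > 0, ∃ ε₀ > 0, ∀ ε ∈ Set.Ioo 0 ε₀,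
      |Cconst r₁ r₂ ε j - (-1) ^ j * muEps r₁ r₂ ε * muConst r₁ r₂ j| ≤ C * ε := by
    intro j
    obtain ⟨C, hC, h⟩ := (isBigO_Cconst_sub hr₁ hr₂ j).exists_pos
    obtain ⟨ε₀, hε₀, h₀⟩ := mem_nhdsGT_iff_exists_Ioo_subset.1 h.bound
    refine ⟨C, hC, ε₀, hε₀, fun ε hε => ?_⟩
    have := h₀ hε
    simpa [abs_of_pos hε.1] using this
  obtain ⟨C₁, hC₁, ε₁, hε₁, h₁⟩ := hb 1
  obtain ⟨C₂, hC₂, ε₂, hε₂, h₂⟩ := hb 2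
  refine ⟨max C₁ C₂, lt_max_of_lt_left hC₁, min ε₁ ε₂, lt_min hε₁ hε₂, ?_⟩
  rintro ε ⟨hε, hlt⟩ j (rfl | rfl)
  · refine (h₁ ε ⟨hε, hlt.trans_le (min_le_left _ _)⟩).trans ?_
    gcongr
    exact le_max_left _ _
  · refine (h₂ ε ⟨hε, hlt.trans_le (min_le_right _ _)⟩).trans ?_
    gcongr
    exact le_max_right _ _

end
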